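/- Let B be an integral graded K-algebra, p ≥ 1 an integer with B_p ≠ 0, and suppose f(p) := liminf_{n→∞} rank(Im(SⁿB_p → B_{np}))/rank(B_{np}) > 0. Let a(p) be the Krull dimension of the graded subalgebra A^{(p)} = ⊕_{n≥0} Im(SⁿB_p → B_{np}) generated by B_p. Then rank(B_n) grows like n^{a(p)−1}, i.e., there exist positive constants c₁, c₂ such that c₁ n^{a(p)−1} ≤ rank(B_n) ≤ c₂ n^{a(p)−1} for all sufficiently large n. -/

import Mathlib

open Module Filter

/-- An integral extension of commutative rings preserves the Krull dimension. -/
theorem ringKrullDim_eq_of_isIntegral (R S : Type*) [CommRing R] [CommRing S] [Algebra R S]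
    [Algebra.IsIntegral R S] [FaithfulSMul R S] : ringKrullDim S = ringKrullDim R := by
  apply le_antisymm
  · exact Order.krullDim_le_of_strictMono (PrimeSpectrum.comap (algebraMap R S))
      fun I J h => Ideal.IsIntegral.comap_lt_comap (I := I.asIdeal) (J := J.asIdeal) h
  · have : Algebra.HasGoingUp R S := ⟨fun {q} hq P hP hlt => by
      obtain ⟨Q, hPQ, hQ, hQq⟩ := Ideal.exists_ideal_over_prime_of_isIntegral q P hlt.le
      exact ⟨Q, hPQ, hQ, ⟨hQq.symm⟩⟩⟩
    refine iSup_le fun l => ?_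
    obtain ⟨⟨P, hP, hPl⟩⟩ := (inferInstance : Nonempty (Ideal.primesOver l.head.asIdeal S))
    obtain ⟨L, hL, -⟩ := Ideal.exists_ltSeries_of_hasGoingUp l P
    rw [← hL]
    exact Order.LTSeries.length_le_krullDim L

theorem Submodule.finrank_mul_le {K A : Type*} [Field K] [CommRing A] [Algebra K A]
    (M N : Submodule K A) [FiniteDimensional K M] [FiniteDimensional K N] :
    finrank K ↥(M * N) ≤ finrank K M * finrank K N := by
  rw [← Submodule.mulMap_range, ← finrank_tensorProduct]
  exact LinearMap.finrank_range_le _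

theorem Submodule.exists_le_of_fg_of_monotone {K M : Type*} [Semiring K] [AddCommMonoid M]
    [Module K M] {F : ℕ → Submodule K M} (hF : Monotone F) {W : Submodule K M} (hW : W.FG)
    (h : ∀ x ∈ W, ∃ n, x ∈ F n) : ∃ n, W ≤ F n := by
  obtain ⟨s, rfl⟩ := hW
  choose! g hg using h
  refine ⟨s.sup g, Submodule.span_le.2 fun x hx => ?_⟩
  exact hF (Finset.le_sup hx) (hg x (Submodule.subset_span hx))

namespace MvPolynomial

theorem restrictDegree_add (σ R : Type*) [Finite σ] [CommSemiring R] (m n : ℕ) :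
    restrictDegree σ R (m + n) = restrictDegree σ R m * restrictDegree σ R n := by
  unfold restrictDegree
  rw [← restrictSupport_add]
  congr 1
  ext f
  simp only [Set.mem_ofPred_eq, Set.mem_add]
  constructor
  · intro hf
    refine ⟨f ⊓ Finsupp.equivFunOnFinite.symm fun _ => m, fun i => by simp,
      f - Finsupp.equivFunOnFinite.symm fun _ => m, fun i => ?_, ?_⟩
    · have := hf i
      simp
      omega
    · ext i
      simp
      omega
  · rintro ⟨x, hx, y, hy, rfl⟩ i
    exact add_le_add (hx i) (hy i)

theorem restrictDegree_mono (σ R : Type*) [CommSemiring R] :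
    Monotone (restrictDegree σ R) :=
  fun _ _ h => restrictSupport_mono _ fun _ hf i => (hf i).trans h

theorem exists_mem_restrictDegree {σ R : Type*} [CommSemiring R] (f : MvPolynomial σ R) :
    ∃ m, f ∈ restrictDegree σ R m :=
  ⟨f.totalDegree, restrictTotalDegree_le_restrictDegree σ R _
    ((mem_restrictTotalDegree _ _ _).2 le_rfl)⟩

theorem finrank_restrictDegree (a : ℕ) (K : Type*) [Field K] (m : ℕ) :
    finrank K (restrictDegree (Fin a) K m) = (m + 1) ^ a := by
  let e : {f : Fin a →₀ ℕ | ∀ i, f i ≤ m} ≃ (Fin a → Fin (m + 1)) :=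
    { toFun f i := ⟨f.1 i, Nat.lt_succ_of_le (f.2 i)⟩
      invFun g := ⟨Finsupp.equivFunOnFinite.symm fun i => (g i : ℕ),
        fun i => Nat.le_of_lt_succ (g i).2⟩
      left_inv f := by ext; simp
      right_inv g := by ext; simp }
  have b := (basisRestrictSupport K {f : Fin a →₀ ℕ | ∀ i, f i ≤ m}).reindex e
  exact (finrank_eq_card_basis b).trans (by simp)

end MvPolynomial

section Growth

variable {K A : Type*} [Field K] [CommRing A] [Algebra K A]

theorem Submodule.monotone_one_sup_pow (V : Submodule K A) :
    Monotone fun n : ℕ => (1 ⊔ V) ^ n :=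
  fun _ _ h => pow_le_pow_right₀ le_sup_left h

theorem Algebra.exists_mem_one_sup_pow_of_mem_adjoin (V : Submodule K A) {x : A}
    (hx : x ∈ Algebra.adjoin K (V : Set A)) : ∃ n : ℕ, x ∈ (1 ⊔ V) ^ n := by
  have mono := V.monotone_one_sup_pow
  induction hx using Algebra.adjoin_induction with
  | mem x hx => exact ⟨1, by simpa using (le_sup_right : V ≤ 1 ⊔ V) hx⟩
  | algebraMap r => exact ⟨0, by simp⟩
  | add x y _ _ hx hy =>
    obtain ⟨m, hm⟩ := hx
    obtain ⟨n, hn⟩ := hy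
    exact ⟨max m n, add_mem (mono (le_max_left m n) hm) (mono (le_max_right m n) hn)⟩
  | mul x y _ _ hx hy =>
    obtain ⟨m, hm⟩ := hx
    obtain ⟨n, hn⟩ := hy
    exact ⟨m + n, pow_add (1 ⊔ V) m n ▸ Submodule.mul_mem_mul hm hn⟩

theorem Submodule.one_sup_pow_le_adjoin (V : Submodule K A) (n : ℕ) :
    (1 ⊔ V) ^ n ≤ Subalgebra.toSubmodule (Algebra.adjoin K (V : Set A)) := by
  induction n with
  | zero => simp [Submodule.one_le]
  | succ n ih =>
    rw [pow_succ, Submodule.mul_le]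
    intro x hx y hy
    have h1 : (1 ⊔ V) ≤ Subalgebra.toSubmodule (Algebra.adjoin K (V : Set A)) :=
      sup_le (Submodule.one_le.2 (one_mem (Algebra.adjoin K (V : Set A)))) Algebra.subset_adjoin
    exact mul_mem (S := Subalgebra K A) (ih hx) (h1 hy)

theorem Submodule.fg_one_sup (V : Submodule K A) [FiniteDimensional K V] : (1 ⊔ V).FG :=
  Submodule.FG.sup (Submodule.one_eq_span (R := K) (A := A) ▸ Submodule.fg_span_singleton 1)
    (Module.Finite.iff_fg.1 inferInstance)

instance Submodule.finiteDimensional_one_sup_pow (V : Submodule K A) [FiniteDimensional K V]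
    (n : ℕ) : FiniteDimensional K ↥((1 ⊔ V) ^ n) :=
  Module.Finite.iff_fg.2 (V.fg_one_sup.pow n)

theorem exists_pow_le_finrank_one_sup_pow (V : Submodule K A) [FiniteDimensional K V] {a : ℕ}
    (φ : MvPolynomial (Fin a) K →ₐ[K] Algebra.adjoin K (V : Set A))
    (hφ : Function.Injective φ) :
    ∃ k : ℕ, ∀ m, (m + 1) ^ a ≤ finrank K ↥((1 ⊔ V) ^ (k * m)) := by
  let ψ := (Algebra.adjoin K (V : Set A)).val.comp φ
  have hψ : Function.Injective ψ := Subtype.val_injective.comp hφ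
  let Q (m : ℕ) := (MvPolynomial.restrictDegree (Fin a) K m).map ψ.toLinearMap
  have hQadd (m n : ℕ) : Q (m + n) = Q m * Q n := by
    simp only [Q, MvPolynomial.restrictDegree_add, Submodule.map_mul]
  obtain ⟨k, hk⟩ := Submodule.exists_le_of_fg_of_monotone V.monotone_one_sup_pow (W := Q 1)
    (Module.Finite.iff_fg.1 inferInstance) (by
      rintro _ ⟨f, -, rfl⟩
      exact Algebra.exists_mem_one_sup_pow_of_mem_adjoin V (φ f).2)
  have hle (m : ℕ) : Q m ≤ (1 ⊔ V) ^ (k * m) := by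
    induction m with
    | zero =>
      rintro _ ⟨f, hf, rfl⟩
      have h : f.totalDegree = 0 := by
        rw [MvPolynomial.totalDegree_eq_zero_iff]
        intro s hs i
        exact Nat.le_zero.1 ((MvPolynomial.mem_restrictDegree _ _ _).1 hf s hs i)
      rw [MvPolynomial.totalDegree_eq_zero_iff_eq_C] at h
      rw [h]
      simp only [mul_zero, pow_zero]
      rw [← MvPolynomial.algebraMap_eq, AlgHom.toLinearMap_apply, AlgHom.commutes]
      exact Submodule.algebraMap_mem _
    | succ m ih =>
      rw [hQadd, mul_add, pow_add, mul_one]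
      exact mul_le_mul' ih hk
  refine ⟨k, fun m => ?_⟩
  rw [← MvPolynomial.finrank_restrictDegree a K m,
    (Submodule.equivMapOfInjective ψ.toLinearMap hψ _).finrank_eq]
  exact Submodule.finrank_mono (hle m)

theorem exists_finrank_one_sup_pow_le (V : Submodule K A) [FiniteDimensional K V] {a : ℕ}
    (φ : MvPolynomial (Fin a) K →ₐ[K] Algebra.adjoin K (V : Set A)) (hφ : φ.Finite) :
    ∃ C : ℕ, ∀ n, finrank K ↥((1 ⊔ V) ^ n) ≤ C * (n + 1) ^ a := by
  let ψ := (Algebra.adjoin K (V : Set A)).val.comp φ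
  let Q (m : ℕ) := (MvPolynomial.restrictDegree (Fin a) K m).map ψ.toLinearMap
  have hQadd (m n : ℕ) : Q (m + n) = Q m * Q n := by
    simp only [Q, MvPolynomial.restrictDegree_add, Submodule.map_mul]
  have hQmono : Monotone Q := fun m n h =>
    Submodule.map_mono (MvPolynomial.restrictDegree_mono _ _ h)
  algebraize [φ.toRingHom]
  obtain ⟨s, hs⟩ := (Module.finite_def (R := MvPolynomial (Fin a) K)
    (M := Algebra.adjoin K (V : Set A))).1 hφ
  let W : Submodule K A :=
    Submodule.span K ((Algebra.adjoin K (V : Set A)).val '' (s : Set _))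
  have hWfg : W.FG := Submodule.fg_span (s.finite_toSet.image _)
  have : FiniteDimensional K W := Module.Finite.iff_fg.2 hWfg
  have hmono : Monotone fun c => Q c * W := fun m n h => mul_le_mul_left (hQmono h) W
  have hmem (x : Algebra.adjoin K (V : Set A)) : ∃ c, (x : A) ∈ Q c * W := by
    have hx : x ∈ Submodule.span (MvPolynomial (Fin a) K) (s : Set _) := hs ▸ trivial
    induction hx using Submodule.span_induction with
    | mem x hx =>
      refine ⟨0, ?_⟩
      rw [← one_mul (x : A)]
      refine Submodule.mul_mem_mul ⟨1, ?_, map_one ψ⟩ (Submodule.subset_span ⟨x, hx, rfl⟩)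
      exact MvPolynomial.restrictTotalDegree_le_restrictDegree _ _ _
        ((MvPolynomial.mem_restrictTotalDegree _ _ _).2 (by simp))
    | zero => exact ⟨0, zero_mem _⟩
    | add x y _ _ hx hy =>
      obtain ⟨m, hm⟩ := hx
      obtain ⟨n, hn⟩ := hy
      exact ⟨max m n, add_mem (hmono (le_max_left m n) hm) (hmono (le_max_right m n) hn)⟩
    | smul f x _ hx =>
      obtain ⟨n, hn⟩ := hx
      obtain ⟨m, hm⟩ := f.exists_mem_restrictDegree
      refine ⟨m + n, ?_⟩
      rw [hQadd, mul_assoc, Algebra.smul_def]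
      exact Submodule.mul_mem_mul ⟨f, hm, rfl⟩ hn
  obtain ⟨c₁, hc₁⟩ := hmem 1
  obtain ⟨c₂, hc₂⟩ := Submodule.exists_le_of_fg_of_monotone hmono (W := (1 ⊔ V) * W)
    (V.fg_one_sup.mul hWfg) (by
      have hW : W ≤ Subalgebra.toSubmodule (Algebra.adjoin K (V : Set A)) := by
        rw [Submodule.span_le]
        rintro _ ⟨x, -, rfl⟩
        exact x.2
      have h1 := Submodule.one_sup_pow_le_adjoin V 1
      rw [pow_one] at h1
      intro x hx
      have : x ∈ Algebra.adjoin K (V : Set A) := by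
        have := mul_le_mul' h1 hW hx
        rwa [(Subalgebra.isIdempotentElem_toSubmodule _).eq] at this
      exact hmem ⟨x, this⟩)
  have key (n : ℕ) : (1 ⊔ V) ^ n * W ≤ Q (c₂ * n) * W := by
    induction n with
    | zero =>
      refine mul_le_mul_left ?_ W
      rw [pow_zero, Submodule.one_le]
      exact ⟨1, MvPolynomial.restrictTotalDegree_le_restrictDegree _ _ _
        ((MvPolynomial.mem_restrictTotalDegree _ _ _).2 (by simp)), map_one ψ⟩
    | succ n ih =>
      calc (1 ⊔ V) ^ (n + 1) * W = (1 ⊔ V) ^ n * ((1 ⊔ V) * W) := by rw [pow_succ, mul_assoc]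
        _ ≤ (1 ⊔ V) ^ n * (Q c₂ * W) := mul_le_mul_right hc₂ _
        _ = Q c₂ * ((1 ⊔ V) ^ n * W) := mul_left_comm _ _ _
        _ ≤ Q c₂ * (Q (c₂ * n) * W) := mul_le_mul_right ih _
        _ = Q (c₂ * (n + 1)) * W := by rw [← mul_assoc, ← hQadd]; congr 2; ring
  refine ⟨(c₁ + c₂ + 1) ^ a * finrank K W, fun n => ?_⟩
  have hle : (1 ⊔ V) ^ n ≤ Q (c₁ + c₂ * n) * W := by
    calc (1 ⊔ V) ^ n = (1 ⊔ V) ^ n * 1 := (mul_one _).symm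
      _ ≤ (1 ⊔ V) ^ n * (Q c₁ * W) := mul_le_mul_right (Submodule.one_le.2 hc₁) _
      _ = Q c₁ * ((1 ⊔ V) ^ n * W) := mul_left_comm _ _ _
      _ ≤ Q c₁ * (Q (c₂ * n) * W) := mul_le_mul_right (key n) _
      _ = Q (c₁ + c₂ * n) * W := by rw [← mul_assoc, ← hQadd]
  have hfd : FiniteDimensional K ↥(Q (c₁ + c₂ * n) * W) :=
    Module.Finite.iff_fg.2 (Submodule.FG.mul (Module.Finite.iff_fg.1 inferInstance) hWfg)
  calc finrank K ↥((1 ⊔ V) ^ n) ≤ finrank K ↥(Q (c₁ + c₂ * n) * W) := Submodule.finrank_mono hle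
    _ ≤ finrank K (Q (c₁ + c₂ * n)) * finrank K W := Submodule.finrank_mul_le _ _
    _ ≤ (c₁ + c₂ * n + 1) ^ a * finrank K W := by
      gcongr
      rw [← MvPolynomial.finrank_restrictDegree a K]
      exact Submodule.finrank_map_le _ _
    _ ≤ ((c₁ + c₂ + 1) * (n + 1)) ^ a * finrank K W := by
      gcongr
      nlinarith [Nat.zero_le (c₁ * n), Nat.zero_le c₂]
    _ = (c₁ + c₂ + 1) ^ a * finrank K W * (n + 1) ^ a := by rw [mul_pow]; ring

end Growth

section Graded

variable {K A : Type*} [Field K] [CommRing A] [Algebra K A]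

theorem Submodule.one_sup_pow_succ (V : Submodule K A) (n : ℕ) :
    (1 ⊔ V) ^ (n + 1) = (1 ⊔ V) ^ n ⊔ V ^ (n + 1) := by
  apply le_antisymm
  · induction n with
    | zero => simp
    | succ n ih =>
      rw [pow_succ, Submodule.mul_sup, mul_one]
      refine sup_le le_sup_left ((mul_le_mul_left ih V).trans ?_)
      rw [Submodule.sup_mul, ← pow_succ]
      refine sup_le_sup_right ?_ _
      rw [pow_succ]
      exact mul_le_mul_right le_sup_right _
  · exact sup_le (V.monotone_one_sup_pow n.le_succ) (pow_le_pow_left₀ bot_le le_sup_right _)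

theorem Submodule.finrank_le_of_mul_mem [IsDomain A] {M N : Submodule K A} [FiniteDimensional K N]
    {v : A} (hv : v ≠ 0) (h : ∀ x ∈ M, v * x ∈ N) : finrank K M ≤ finrank K N := by
  refine LinearMap.finrank_le_finrank_of_injective
    (f := (LinearMap.mulLeft K v).restrict (p := M) (q := N) h) fun x y hxy => ?_
  exact Subtype.ext (mul_left_cancel₀ hv (congrArg Subtype.val hxy))

theorem Submodule.finrank_pow_monotone [IsDomain A] {V : Submodule K A} [FiniteDimensional K V]
    (hV : V ≠ ⊥) : Monotone fun n : ℕ => finrank K ↥(V ^ n) := by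
  refine monotone_nat_of_le_succ fun n => ?_
  obtain ⟨v, hv, hv0⟩ := Submodule.exists_mem_ne_zero_of_ne_bot hV
  have : FiniteDimensional K ↥(V ^ (n + 1)) :=
    Module.Finite.iff_fg.2 (Submodule.FG.pow (Module.Finite.iff_fg.1 inferInstance) _)
  refine Submodule.finrank_le_of_mul_mem hv0 fun x hx => ?_
  rw [pow_succ']
  exact Submodule.mul_mem_mul hv hx

variable (𝒜 : ℕ → Submodule K A) [GradedAlgebra 𝒜]

theorem GradedAlgebra.pow_le (p n : ℕ) : 𝒜 p ^ n ≤ 𝒜 (n * p) := by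
  induction n with
  | zero => simpa [Submodule.one_le] using SetLike.GradedOne.one_mem
  | succ n ih =>
    rw [pow_succ, Submodule.mul_le]
    intro x hx y hy
    rw [add_mul, one_mul]
    exact SetLike.GradedMul.mul_mem (ih hx) hy

theorem GradedAlgebra.one_sup_pow_le_ker_proj (p n j : ℕ) (hj : n * p < j) :
    (1 ⊔ 𝒜 p) ^ n ≤ LinearMap.ker (GradedAlgebra.proj 𝒜 j) := by
  have h (i : ℕ) (hi : i * p < j) : 𝒜 p ^ i ≤ LinearMap.ker (GradedAlgebra.proj 𝒜 j) := by
    intro x hx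
    rw [LinearMap.mem_ker, GradedAlgebra.proj_apply]
    exact DirectSum.decompose_of_mem_ne 𝒜 (GradedAlgebra.pow_le 𝒜 p i hx) hi.ne
  induction n with
  | zero => simpa using h 0 hj
  | succ n ih =>
    rw [Submodule.one_sup_pow_succ]
    exact sup_le (ih (by nlinarith)) (h _ hj)

theorem GradedAlgebra.finrank_one_sup_pow {p : ℕ} (hp : 1 ≤ p) [FiniteDimensional K (𝒜 p)]
    (n : ℕ) : finrank K ↥((1 ⊔ 𝒜 p) ^ n) = ∑ i ∈ Finset.range (n + 1), finrank K ↥(𝒜 p ^ i) := by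
  induction n with
  | zero => rw [zero_add, Finset.sum_range_one, pow_zero, pow_zero]
  | succ n ih =>
    have : FiniteDimensional K ↥(𝒜 p ^ (n + 1)) :=
      Module.Finite.iff_fg.2 (Submodule.FG.pow (Module.Finite.iff_fg.1 inferInstance) _)
    have hdisj : (1 ⊔ 𝒜 p) ^ n ⊓ 𝒜 p ^ (n + 1) = ⊥ := by
      rw [eq_bot_iff]
      rintro x ⟨hx, hx'⟩
      have h1 := GradedAlgebra.one_sup_pow_le_ker_proj 𝒜 p n ((n + 1) * p) (by nlinarith) hx
      rw [LinearMap.mem_ker, GradedAlgebra.proj_apply,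
        DirectSum.decompose_of_mem_same 𝒜 (GradedAlgebra.pow_le 𝒜 p _ hx')] at h1
      exact h1
    rw [Finset.sum_range_succ, ← ih, Submodule.one_sup_pow_succ,
      ← Submodule.finrank_sup_add_finrank_inf_eq, hdisj, finrank_bot, add_zero]

end Graded

/-- A monotone sequence whose partial sums grow like `n ^ a` grows like `n ^ (a - 1)`. -/
theorem Nat.pow_growth_of_sum_growth {h : ℕ → ℕ} (hmono : Monotone h) (h0 : 0 < h 0) {a k C : ℕ}
    (hlow : ∀ m, (m + 1) ^ a ≤ ∑ i ∈ Finset.range (k * m + 1), h i)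
    (hup : ∀ n, ∑ i ∈ Finset.range (n + 1), h i ≤ C * (n + 1) ^ a) :
    ∃ D : ℕ, 0 < D ∧ ∀ n ≥ 1, h n ≤ D * n ^ (a - 1) ∧ n ^ (a - 1) ≤ D * h n := by
  have ha : a ≠ 0 := by
    rintro rfl
    have h1 : ∑ i ∈ Finset.range (C + 1), 1 ≤ ∑ i ∈ Finset.range (C + 1), h i :=
      Finset.sum_le_sum fun i _ => h0.trans_le (hmono i.zero_le)
    have h2 := hup C
    simp at h1 h2
    omega
  obtain ⟨b, rfl⟩ := Nat.exists_eq_succ_of_ne_zero ha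
  simp only [Nat.succ_eq_add_one, Nat.add_sub_cancel] at *
  refine ⟨C * 3 ^ (b + 1) + (k + 1) ^ (b + 1), by positivity, fun n hn => ⟨?_, ?_⟩⟩
  · have h1 : n * h n ≤ ∑ i ∈ Finset.range (2 * n + 1), h i := by
      have : ∑ i ∈ Finset.Ico n (2 * n), h n ≤ ∑ i ∈ Finset.Ico n (2 * n), h i :=
        Finset.sum_le_sum fun i hi => hmono (Finset.mem_Ico.1 hi).1
      rw [Finset.sum_const, Nat.card_Ico, smul_eq_mul, two_mul, Nat.add_sub_cancel] at this
      refine this.trans (Finset.sum_le_sum_of_subset fun i hi => ?_)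
      simp only [Finset.mem_Ico, Finset.mem_range] at hi ⊢
      omega
    have h2 : C * (2 * n + 1) ^ (b + 1) ≤ C * (3 * n) ^ (b + 1) := by
      gcongr
      omega
    have h3 : n * h n ≤ n * (C * 3 ^ (b + 1) * n ^ b) := by
      calc n * h n ≤ C * (3 * n) ^ (b + 1) := h1.trans ((hup _).trans h2)
        _ = n * (C * 3 ^ (b + 1) * n ^ b) := by ring
    refine (Nat.le_of_mul_le_mul_left h3 hn).trans ?_
    gcongr
    exact Nat.le_add_right _ _
  · set m := n / (k + 1) with hm
    have hmn : (k + 1) * m ≤ n := Nat.mul_div_le n _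
    have hnm : n ≤ (k + 1) * (m + 1) := (Nat.lt_mul_div_succ n k.succ_pos).le
    have h1 : (m + 1) ^ (b + 1) ≤ (m + 1) * ((k + 1) * h n) := by
      calc (m + 1) ^ (b + 1) ≤ ∑ i ∈ Finset.range (k * m + 1), h i := hlow m
        _ ≤ ∑ i ∈ Finset.range (k * m + 1), h n := Finset.sum_le_sum fun i hi =>
            hmono (by have := Finset.mem_range.1 hi; nlinarith)
        _ = (k * m + 1) * h n := by simp
        _ ≤ ((m + 1) * (k + 1)) * h n := by gcongr; nlinarith
        _ = _ := mul_assoc _ _ _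
    rw [pow_succ'] at h1
    calc n ^ b ≤ ((k + 1) * (m + 1)) ^ b := by gcongr
      _ = (k + 1) ^ b * (m + 1) ^ b := mul_pow _ _ _
      _ ≤ (k + 1) ^ b * ((k + 1) * h n) :=
        Nat.mul_le_mul_left _ (Nat.le_of_mul_le_mul_left h1 m.succ_pos)
      _ = (k + 1) ^ (b + 1) * h n := by ring
      _ ≤ _ := by gcongr; exact Nat.le_add_left _ _

/-- The Hilbert function of the subalgebra generated by `𝒜 p` grows like `n ^ (a - 1)`, with `a`
its Krull dimension. -/
theorem GradedAlgebra.finrank_pow_growth {K A : Type*} [Field K] [CommRing A] [IsDomain A]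
    [Algebra K A] (𝒜 : ℕ → Submodule K A) [GradedAlgebra 𝒜] {p : ℕ} (hp : 1 ≤ p)
    [FiniteDimensional K (𝒜 p)] (hBp : 𝒜 p ≠ ⊥) {a : ℕ}
    (ha : ringKrullDim ↥(Algebra.adjoin K ((𝒜 p : Set A))) = (a : WithBot (WithTop ℕ))) :
    ∃ D : ℕ, 0 < D ∧ ∀ n ≥ 1, finrank K ↥(𝒜 p ^ n) ≤ D * n ^ (a - 1) ∧
      n ^ (a - 1) ≤ D * finrank K ↥(𝒜 p ^ n) := by
  have hft : Algebra.FiniteType K (Algebra.adjoin K (𝒜 p : Set A)) := by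
    obtain ⟨s, hs⟩ := Module.Finite.iff_fg.1 (inferInstance : FiniteDimensional K (𝒜 p))
    rw [← hs, Algebra.adjoin_span]
    exact (Subalgebra.fg_iff_finiteType _).1 (Subalgebra.fg_adjoin_finset s)
  obtain ⟨r, φ, hinj, hfin⟩ :=
    exists_finite_inj_algHom_of_fg K (Algebra.adjoin K (𝒜 p : Set A))
  have hr : r = a := by
    algebraize [φ.toRingHom]
    have : Module.Finite (MvPolynomial (Fin r) K) (Algebra.adjoin K (𝒜 p : Set A)) := hfin
    have : FaithfulSMul (MvPolynomial (Fin r) K) (Algebra.adjoin K (𝒜 p : Set A)) :=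
      (faithfulSMul_iff_algebraMap_injective _ _).2 hinj
    rw [ringKrullDim_eq_of_isIntegral (MvPolynomial (Fin r) K),
      MvPolynomial.ringKrullDim_of_isNoetherianRing, ringKrullDim_eq_zero_of_field] at ha
    simp only [Nat.card_eq_fintype_card, Fintype.card_fin, zero_add] at ha
    exact Nat.cast_injective (R := WithBot ℕ∞) ha
  subst hr
  obtain ⟨k, hk⟩ := exists_pow_le_finrank_one_sup_pow (𝒜 p) φ hinj
  obtain ⟨C, hC⟩ := exists_finrank_one_sup_pow_le (𝒜 p) φ hfin
  have h0 : 0 < finrank K ↥(𝒜 p ^ 0) := by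
    rw [pow_zero, Submodule.one_eq_span, finrank_span_singleton one_ne_zero]
    exact one_pos
  exact Nat.pow_growth_of_sum_growth (Submodule.finrank_pow_monotone hBp) h0
    (fun m => (hk m).trans_eq (GradedAlgebra.finrank_one_sup_pow 𝒜 hp _))
    (fun n => (GradedAlgebra.finrank_one_sup_pow 𝒜 hp n).symm.trans_le (hC n))

/-- Let `B` be an integral graded `K`-algebra (graded pieces
`𝒜 n`), `p ≥ 1` with `B_p ≠ 0`, and suppose
`f(p) = liminfₙ rank Im(Sⁿ B_p → B_{np}) / rank B_{np} > 0`. If `a(p)` is the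
Krull dimension of the subalgebra generated by `B_p`, then `rank B_n` grows
like `n^{a(p)-1}`: there are constants `c₁, c₂ > 0` with
`c₁ n^{a(p)-1} ≤ rank B_n ≤ c₂ n^{a(p)-1}` for all large `n`. -/
theorem stmt6 {K A : Type*} [Field K] [CommRing A] [IsDomain A] [Algebra K A]
    (𝒜 : ℕ → Submodule K A) [GradedAlgebra 𝒜]
    (hfin : ∀ n, FiniteDimensional K ↥(𝒜 n))
    (hne : ∃ N : ℕ, ∀ n ≥ N, 𝒜 n ≠ ⊥)
    (p : ℕ) (hp : 1 ≤ p) (hBp : 𝒜 p ≠ ⊥)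
    (hfp : 0 < Filter.liminf
      (fun n : ℕ => (finrank K ↥((𝒜 p) ^ n) : ℝ) / (finrank K ↥(𝒜 (n * p)) : ℝ))
      Filter.atTop)
    (a : ℕ)
    (ha : ringKrullDim ↥(Algebra.adjoin K ((𝒜 p : Set A))) = (a : WithBot (WithTop ℕ))) :
    ∃ c₁ c₂ : ℝ, 0 < c₁ ∧ 0 < c₂ ∧ ∃ N : ℕ, ∀ n ≥ N,
      c₁ * (n : ℝ) ^ (a - 1) ≤ (finrank K ↥(𝒜 n) : ℝ) ∧
      (finrank K ↥(𝒜 n) : ℝ) ≤ c₂ * (n : ℝ) ^ (a - 1) := by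
  obtain ⟨D, hD0, hD⟩ := GradedAlgebra.finrank_pow_growth 𝒜 hp hBp ha
  obtain ⟨N₀, hN₀⟩ := hne
  have hmono (n m : ℕ) (hm : N₀ ≤ m) : finrank K (𝒜 n) ≤ finrank K (𝒜 (n + m)) := by
    obtain ⟨v, hv, hv0⟩ := Submodule.exists_mem_ne_zero_of_ne_bot (hN₀ m hm)
    refine Submodule.finrank_le_of_mul_mem hv0 fun x hx => ?_
    rw [add_comm]
    exact SetLike.GradedMul.mul_mem hv hx
  obtain ⟨δ, hδ0, hδ⟩ := exists_between hfp
  have hbdd : IsBoundedUnder (· ≥ ·) atTop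
      (fun n : ℕ => (finrank K ↥((𝒜 p) ^ n) : ℝ) / (finrank K ↥(𝒜 (n * p)) : ℝ)) :=
    isBoundedUnder_of ⟨0, fun n => by positivity⟩
  obtain ⟨N₁, hN₁⟩ := eventually_atTop.1 (eventually_lt_of_lt_liminf hδ hbdd)
  have hupper (q : ℕ) (hq : N₁ ≤ q) :
      δ * (finrank K (𝒜 (q * p)) : ℝ) ≤ finrank K ↥(𝒜 p ^ q) := by
    have h1 := hN₁ q hq
    rcases (Nat.cast_nonneg (α := ℝ) (finrank K (𝒜 (q * p)))).eq_or_lt with h0 | h0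
    · rw [← h0, mul_zero]
      positivity
    · exact ((lt_div_iff₀ h0).1 h1).le
  have hlower (q : ℕ) : finrank K ↥(𝒜 p ^ q) ≤ finrank K (𝒜 (q * p)) :=
    Submodule.finrank_mono (GradedAlgebra.pow_le 𝒜 p q)
  have hD0' : (0 : ℝ) < D := by exact_mod_cast hD0
  have hp0 : (0 : ℝ) < p := by exact_mod_cast hp
  refine ⟨1 / ((2 * p) ^ (a - 1) * D), D * 2 ^ (a - 1) / δ, by positivity, by positivity,
    2 * (N₀ + p) + (N₁ + 1) * p, fun n hn => ⟨?_, ?_⟩⟩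
  · set q := (n - N₀) / p with hq
    have hqm : p * q + (n - N₀) % p = n - N₀ := Nat.div_add_mod _ _
    have hmod : (n - N₀) % p < p := Nat.mod_lt _ hp
    have hpp : p ≤ (N₁ + 1) * p := Nat.le_mul_of_pos_left _ N₁.succ_pos
    clear_value q
    have hnq : n ≤ 2 * p * q := by
      rw [mul_assoc]
      omega
    have hq1 : 1 ≤ q := by
      by_contra! h
      have : q = 0 := by omega
      rw [this] at hnq
      omega
    have hle : finrank K (𝒜 (q * p)) ≤ finrank K (𝒜 n) := by
      have := hmono (q * p) (N₀ + (n - N₀) % p) (Nat.le_add_right _ _)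
      rwa [show q * p + (N₀ + (n - N₀) % p) = n by rw [mul_comm]; omega] at this
    rw [div_mul_eq_mul_div, one_mul, div_le_iff₀ (by positivity)]
    have key : n ^ (a - 1) ≤ finrank K (𝒜 n) * ((2 * p) ^ (a - 1) * D) := by
      calc n ^ (a - 1) ≤ (2 * p * q) ^ (a - 1) := Nat.pow_le_pow_left hnq _
        _ = (2 * p) ^ (a - 1) * q ^ (a - 1) := mul_pow _ _ _
        _ ≤ (2 * p) ^ (a - 1) * (D * finrank K (𝒜 n)) :=
          Nat.mul_le_mul_left _ ((hD q hq1).2.trans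
            (Nat.mul_le_mul_left _ ((hlower q).trans hle)))
        _ = _ := by ring
    exact_mod_cast key
  · set q := (n + N₀ + p) / p with hq
    have hqm : p * q + (n + N₀ + p) % p = n + N₀ + p := Nat.div_add_mod _ _
    have hmod : (n + N₀ + p) % p < p := Nat.mod_lt _ hp
    have hqN : N₁ + 1 ≤ q := (Nat.le_div_iff_mul_le hp).2 (by omega)
    have hq2 : q ≤ 2 * n := by
      have : q ≤ p * q := Nat.le_mul_of_pos_left _ hp
      omega
    have hle : finrank K (𝒜 n) ≤ finrank K (𝒜 (q * p)) := by
      have := hmono n (p * q - n) (by omega)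
      rwa [show n + (p * q - n) = q * p by rw [mul_comm q]; omega] at this
    rw [div_mul_eq_mul_div, le_div_iff₀ hδ0]
    calc (finrank K (𝒜 n) : ℝ) * δ ≤ δ * finrank K (𝒜 (q * p)) := by
          rw [mul_comm]
          gcongr
      _ ≤ finrank K ↥(𝒜 p ^ q) := hupper q (by omega)
      _ ≤ D * (q : ℝ) ^ (a - 1) := by exact_mod_cast (hD q (by omega)).1
      _ ≤ D * (2 * n : ℝ) ^ (a - 1) := by
          gcongr
          exact_mod_cast hq2
      _ = D * 2 ^ (a - 1) * (n : ℝ) ^ (a - 1) := by rw [mul_pow]; ring
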